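/- arXiv:2303.13923 — 3 statements merged into one kernel-verified Lean document; each statement's English description precedes it below -/
import Mathlib

section
/- Let g be a cubic graph having at least two bridges. Then for every edge ε of g and each of the two Whitehead moves, the resulting graph w_ε^{(i)}(g) (i = 1, 2) still has a bridge. -/
/-! Cubic multigraphs in the dart (half-edge) model, Whitehead moves,
and the "graph of graphs" `Γ_n`. -/

/-- A cubic multigraph on the `2 * n` vertices `Fin (2 * n)`, in the dart (half-edge) model:
darts are `Fin (6 * n)`, `dinv` is the fixed-point-free involution exchanging the two darts of
each edge, and `vert` assigns to each dart its base vertex.  Loops and multiple edges are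
allowed; `regular` says every vertex carries exactly three darts. -/
structure CubicGraph (n : ℕ) where
  vert : Fin (6 * n) → Fin (2 * n)
  dinv : Fin (6 * n) → Fin (6 * n)
  dinv_invol : ∀ d, dinv (dinv d) = d
  dinv_ne : ∀ d, dinv d ≠ d
  regular : ∀ v : Fin (2 * n), (Finset.univ.filter fun d => vert d = v).card = 3

namespace CubicGraph

variable {n : ℕ}

/-- Two darts are joined if they can be connected by a chain of
"same vertex" / "other half of the same edge" steps. -/
def Reach (g : CubicGraph n) : Fin (6 * n) → Fin (6 * n) → Prop :=
  Relation.ReflTransGen fun a b => g.vert a = g.vert b ∨ g.dinv a = b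

/-- Connectivity of a cubic multigraph. -/
def Connected (g : CubicGraph n) : Prop := ∀ d d', g.Reach d d'

/-- The edge of the dart `d` is a loop. -/
def IsLoop (g : CubicGraph n) (d : Fin (6 * n)) : Prop := g.vert (g.dinv d) = g.vert d

instance (g : CubicGraph n) (d : Fin (6 * n)) : Decidable (g.IsLoop d) :=
  inferInstanceAs (Decidable (_ = _))

lemma card_filter_comp_swap (g : CubicGraph n) (q r : Fin (6 * n)) (v : Fin (2 * n)) :
    (Finset.univ.filter fun d => g.vert (Equiv.swap q r d) = v).card
      = (Finset.univ.filter fun d => g.vert d = v).card := by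
  refine Finset.card_bij (fun d _ => Equiv.swap q r d) ?_ ?_ ?_
  · intro a ha
    simp only [Finset.mem_filter, Finset.mem_univ, true_and] at ha ⊢
    exact ha
  · intro a _ b _ h
    exact (Equiv.swap q r).injective h
  · intro b hb
    simp only [Finset.mem_filter, Finset.mem_univ, true_and] at hb
    exact ⟨Equiv.swap q r b, by simp [hb], by simp⟩

/-- Exchange the base vertices of the two darts `q` and `r`, keeping everything else. -/
def swapDarts (g : CubicGraph n) (q r : Fin (6 * n)) : CubicGraph n where
  vert := fun d => g.vert (Equiv.swap q r d)
  dinv := g.dinv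
  dinv_invol := g.dinv_invol
  dinv_ne := g.dinv_ne
  regular := fun v => (g.card_filter_comp_swap q r v).trans (g.regular v)

/-- The darts based at the same vertex as `x`, other than `x` itself. -/
def othersAt (g : CubicGraph n) (x : Fin (6 * n)) : Finset (Fin (6 * n)) :=
  (Finset.univ.filter fun d => g.vert d = g.vert x).erase x

lemma othersAt_nonempty (g : CubicGraph n) (x : Fin (6 * n)) :
    (g.othersAt x).Nonempty := by
  have hx : x ∈ Finset.univ.filter fun d => g.vert d = g.vert x := by simp
  have h : (g.othersAt x).card = 2 := by
    rw [othersAt, Finset.card_erase_of_mem hx, g.regular]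
  rw [← Finset.card_pos, h]
  norm_num

def oMin (g : CubicGraph n) (x : Fin (6 * n)) : Fin (6 * n) :=
  (g.othersAt x).min' (g.othersAt_nonempty x)

def oMax (g : CubicGraph n) (x : Fin (6 * n)) : Fin (6 * n) :=
  (g.othersAt x).max' (g.othersAt_nonempty x)

/-- The two Whitehead moves (indexed by `i : Fin 2`) performed on the edge containing the dart
`x`.  On a loop the move leaves the graph unchanged; on a non-loop edge the two darts at the
endpoints of the edge other than the edge's own darts are re-attached in one of the two
possible new ways (realized by transporting one dart from each endpoint to the other). -/
def wh (g : CubicGraph n) (i : Fin 2) (x : Fin (6 * n)) : CubicGraph n :=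
  if g.IsLoop x then g
  else if i = 0 then g.swapDarts (g.oMax x) (g.oMin (g.dinv x))
  else g.swapDarts (g.oMax x) (g.oMax (g.dinv x))

/-- An isomorphism of cubic multigraphs: a bijection of darts together with a compatible
bijection of vertices, commuting with the edge involutions. -/
structure Iso (g₁ g₂ : CubicGraph n) where
  dartEquiv : Fin (6 * n) ≃ Fin (6 * n)
  vertEquiv : Fin (2 * n) ≃ Fin (2 * n)
  map_dinv : ∀ d, g₂.dinv (dartEquiv d) = dartEquiv (g₁.dinv d)
  map_vert : ∀ d, g₂.vert (dartEquiv d) = vertEquiv (g₁.vert d)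

def IsIsomorphic (g₁ g₂ : CubicGraph n) : Prop := Nonempty (Iso g₁ g₂)

/-- Reachability avoiding the edge of the dart `x` (i.e. in the graph with that edge removed). -/
def ReachAvoiding (g : CubicGraph n) (x : Fin (6 * n)) :
    Fin (6 * n) → Fin (6 * n) → Prop :=
  Relation.ReflTransGen fun a b =>
    g.vert a = g.vert b ∨ (g.dinv a = b ∧ a ≠ x ∧ a ≠ g.dinv x)

/-- The edge of `x` is a bridge: removing it disconnects the graph. -/
def IsBridge (g : CubicGraph n) (x : Fin (6 * n)) : Prop :=
  ¬ ∀ d d', g.ReachAvoiding x d d'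

/-- A (connected) graph is bridged if it has at least one bridge. -/
def Bridged (g : CubicGraph n) : Prop := ∃ x, g.IsBridge x

/-- A graph is bridgeless if it has no bridge. -/
def Bridgeless (g : CubicGraph n) : Prop := ∀ x, ¬ g.IsBridge x

/-- `c` lists consecutive darts of a cycle of length `k`: the vertices visited are pairwise
distinct, the end of each dart's edge is the base of the next one (cyclically), and the `k`
edges used are pairwise distinct. -/
def IsCycle (g : CubicGraph n) (k : ℕ) (c : Fin k → Fin (6 * n)) : Prop :=
  (∀ i : Fin k,
    g.vert (g.dinv (c i)) = g.vert (c ⟨(i.1 + 1) % k, Nat.mod_lt _ i.pos⟩)) ∧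
  Function.Injective (fun i => g.vert (c i)) ∧
  ∀ i j : Fin k, c j ≠ g.dinv (c i)

/-- The cycle `c` is indecomposable (induced): no edge of `g` other than the cycle's own
edges joins two vertices of the cycle. -/
def Indecomposable (g : CubicGraph n) (k : ℕ) (c : Fin k → Fin (6 * n)) : Prop :=
  ∀ d, (∃ i, g.vert d = g.vert (c i)) → (∃ j, g.vert (g.dinv d) = g.vert (c j)) →
    ∃ i, d = c i ∨ d = g.dinv (c i)

/-- The girth: the least length of a cycle. -/
noncomputable def girth (g : CubicGraph n) : ℕ :=
  sInf {k | 0 < k ∧ ∃ c : Fin k → Fin (6 * n), g.IsCycle k c}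

/-- The only cycles of the graph are loops. -/
def OnlyLoopCycles (g : CubicGraph n) : Prop :=
  ∀ k, 2 ≤ k → ∀ c : Fin k → Fin (6 * n), ¬ g.IsCycle k c

/-- The number of darts lying on loops (each loop contributes two darts). -/
def loopCount (g : CubicGraph n) : ℕ :=
  (Finset.univ.filter fun d => g.IsLoop d).card

end CubicGraph

instance {n : ℕ} : Finite (CubicGraph n) := by
  have hinj : Function.Injective fun g : CubicGraph n => (g.vert, g.dinv) := by
    rintro ⟨v₁, i₁, _, _, _⟩ ⟨v₂, i₂, _, _, _⟩ h
    simp only [Prod.mk.injEq] at h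
    obtain ⟨h₁, h₂⟩ := h
    subst h₁; subst h₂; rfl
  exact Finite.of_injective _ hinj

/-- Isomorphism of connected cubic graphs. -/
def cgIso {n : ℕ} (g₁ g₂ : {g : CubicGraph n // g.Connected}) : Prop :=
  CubicGraph.IsIsomorphic g₁.1 g₂.1

/-- The vertex set of the graph of graphs `Γ_n`: isomorphism classes of connected cubic
multigraphs on `2 * n` vertices. -/
abbrev GammaV (n : ℕ) := Quot (@cgIso n)

/-- The number of directed edges of `Γ_n` from the class `u` to the class `v`: one edge for
each Whitehead move of a representative of `u` whose result lies in the class `v`.  A move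
specification is a pair `(i, x)` of a move type `i : Fin 2` and a dart `x`; each of the two
Whitehead moves of each edge is counted by exactly two specifications (one for each of the
two darts of the edge), whence the division by `2`. -/
noncomputable def edgeMult (n : ℕ) (u v : GammaV n) : ℕ :=
  Nat.card {p : Fin 2 × Fin (6 * n) //
    CubicGraph.IsIsomorphic ((Quot.out u).1.wh p.1 p.2) (Quot.out v).1} / 2

/-- The sum of out-degrees of the classes in `S` (every class has out-degree `6 * n`:
two Whitehead moves for each of the `3 * n` edges). -/
noncomputable def dOut (n : ℕ) (S : Set (GammaV n)) : ℕ :=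
  Nat.card {q : GammaV n × Fin 2 × Fin (6 * n) // q.1 ∈ S} / 2

/-- The number of directed edges of `Γ_n` from `S` to its complement. -/
noncomputable def boundaryCount (n : ℕ) (S : Set (GammaV n)) : ℕ :=
  Nat.card {q : GammaV n × Fin 2 × Fin (6 * n) // q.1 ∈ S ∧
    ∀ v : GammaV n,
      CubicGraph.IsIsomorphic ((Quot.out q.1).1.wh q.2.1 q.2.2) (Quot.out v).1 → v ∉ S} / 2

/-- The outer conductance of a set `S` of vertices of `Γ_n`. -/
noncomputable def phiOutSet (n : ℕ) (S : Set (GammaV n)) : ℝ :=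
  (boundaryCount n S : ℝ) / min (dOut n S : ℝ) (dOut n Sᶜ : ℝ)

/-- The outer conductance of `Γ_n`: the infimum of the outer conductances of nonempty
proper subsets of vertices. -/
noncomputable def phiOut (n : ℕ) : ℝ :=
  sInf {x : ℝ | ∃ S : Set (GammaV n), S.Nonempty ∧ Sᶜ.Nonempty ∧ x = phiOutSet n S}

/-- The set of classes of bridged cubic graphs. -/
def bridgedSet (n : ℕ) : Set (GammaV n) := {u | (Quot.out u).1.Bridged}

namespace CubicGraph

variable {n : ℕ}

lemma vert_oMax (g : CubicGraph n) (x : Fin (6 * n)) : g.vert (g.oMax x) = g.vert x := by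
  have h := (g.othersAt x).max'_mem (g.othersAt_nonempty x)
  simp only [othersAt, Finset.mem_erase, Finset.mem_filter] at h
  exact h.2.2

lemma vert_oMin (g : CubicGraph n) (x : Fin (6 * n)) : g.vert (g.oMin x) = g.vert x := by
  have h := (g.othersAt x).min'_mem (g.othersAt_nonempty x)
  simp only [othersAt, Finset.mem_erase, Finset.mem_filter] at h
  exact h.2.2

/-- Darts at the two endpoints of an edge other than that of `x` are joined avoiding `x`. -/
lemma reachAvoiding_of_vert_eq (g : CubicGraph n) {x e q r : Fin (6 * n)}
    (hex : e ≠ x) (hex' : e ≠ g.dinv x) (hq : g.vert q = g.vert e)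
    (hr : g.vert r = g.vert (g.dinv e)) : g.ReachAvoiding x q r :=
  .head (Or.inl hq) (.head (Or.inr ⟨rfl, hex, hex'⟩) (.single (Or.inl hr.symm)))

/-- Exchanging darts at the two endpoints of an edge keeps every other bridge a bridge. -/
lemma IsBridge.swapDarts {g : CubicGraph n} {x e q r : Fin (6 * n)} (hx : g.IsBridge x)
    (hex : e ≠ x) (hex' : e ≠ g.dinv x) (hq : g.vert q = g.vert e)
    (hr : g.vert r = g.vert (g.dinv e)) : (g.swapDarts q r).IsBridge x := by
  have hqr : g.ReachAvoiding x q r := g.reachAvoiding_of_vert_eq hex hex' hq hr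
  have hrq : g.ReachAvoiding x r q := by
    refine g.reachAvoiding_of_vert_eq (e := g.dinv e) ?_ ?_ hr (by rw [g.dinv_invol, hq])
    · intro h
      exact hex' (by rw [← h, g.dinv_invol])
    · intro h
      exact hex (by rw [← g.dinv_invol e, h, g.dinv_invol])
  have hswap : ∀ a, g.ReachAvoiding x a (Equiv.swap q r a) ∧
      g.ReachAvoiding x (Equiv.swap q r a) a := by
    intro a
    rcases eq_or_ne a q with rfl | haq
    · rw [Equiv.swap_apply_left]
      exact ⟨hqr, hrq⟩
    rcases eq_or_ne a r with rfl | har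
    · rw [Equiv.swap_apply_right]
      exact ⟨hrq, hqr⟩
    rw [Equiv.swap_apply_of_ne_of_ne haq har]
    exact ⟨.refl, .refl⟩
  intro hall
  refine hx fun d d' => ?_
  induction hall d d' with
  | refl => exact .refl
  | tail _ hstep ih =>
    rcases hstep with h | h
    · exact ((ih.trans (hswap _).1).tail (Or.inl h)).trans (hswap _).2
    · exact ih.tail (Or.inr h)

/-- A Whitehead move keeps every bridge other than the edge it is performed on. -/
lemma IsBridge.wh {g : CubicGraph n} {x e : Fin (6 * n)} (hx : g.IsBridge x)
    (hex : e ≠ x) (hex' : e ≠ g.dinv x) (i : Fin 2) : (g.wh i e).IsBridge x := by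
  unfold CubicGraph.wh
  split_ifs
  · exact hx
  · exact hx.swapDarts hex hex' (g.vert_oMax e) (g.vert_oMin _)
  · exact hx.swapDarts hex hex' (g.vert_oMax e) (g.vert_oMax _)

end CubicGraph

/-- If a connected cubic graph has at least two (distinct) bridges, then the
result of every Whitehead move still has a bridge. -/
theorem two_bridges_move_still_bridged (n : ℕ) (g : CubicGraph n) (hg : g.Connected)
    (x y : Fin (6 * n)) (hx : g.IsBridge x) (hy : g.IsBridge y)
    (hyx : y ≠ x) (hyx' : y ≠ g.dinv x) :
    ∀ (ε : Fin (6 * n)) (i : Fin 2), (g.wh i ε).Bridged := by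
  intro ε i
  by_cases hε : ε = x ∨ ε = g.dinv x
  · refine ⟨y, hy.wh ?_ ?_ i⟩
    · rintro rfl
      exact hε.elim hyx hyx'
    · rintro rfl
      rcases hε with h | h
      · exact hyx' (by rw [← h, g.dinv_invol])
      · exact hyx (by rw [← g.dinv_invol y, h, g.dinv_invol])
  · rw [not_or] at hε
    exact ⟨x, hx.wh hε.1 hε.2 i⟩
end

section
/- Let g be a cubic graph and let ε be a bridge of g such that removing ε leaves two bridgeless components (equivalently, ε is the unique bridge of g). Then both Whitehead moves on ε produce a bridgeless graph: w_ε^{(1)}(g) and w_ε^{(2)}(g) have no bridges. -/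
namespace CubicGraph

variable {n : ℕ}

/-- An edge is a bridge iff it is the only edge possibly crossing some cut of the vertices
that separates two darts. -/
lemma isBridge_iff_exists_cut (g : CubicGraph n) (x : Fin (6 * n)) :
    g.IsBridge x ↔ ∃ P : Fin (2 * n) → Prop, (∃ d d', P (g.vert d) ∧ ¬ P (g.vert d')) ∧
      ∀ d, d ≠ x → d ≠ g.dinv x → (P (g.vert d) ↔ P (g.vert (g.dinv d))) := by
  constructor
  · intro h
    simp only [IsBridge, not_forall] at h
    obtain ⟨d, d', h⟩ := h
    have key : ∀ e, (∃ f, g.vert f = g.vert e ∧ g.ReachAvoiding x d f) ↔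
        g.ReachAvoiding x d e :=
      fun e => ⟨fun ⟨_, hf, hr⟩ => hr.tail (Or.inl hf), fun hr => ⟨e, rfl, hr⟩⟩
    refine ⟨fun w => ∃ e, g.vert e = w ∧ g.ReachAvoiding x d e, ⟨d, d', ?_, ?_⟩, ?_⟩
    · exact ⟨d, rfl, Relation.ReflTransGen.refl⟩
    · beta_reduce
      rwa [key]
    · intro e h₁ h₂
      beta_reduce
      rw [key, key]
      refine ⟨fun hr => hr.tail (Or.inr ⟨rfl, h₁, h₂⟩),
        fun hr => hr.tail (Or.inr ⟨g.dinv_invol e, ?_, ?_⟩)⟩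
      · rintro rfl
        exact h₂ (g.dinv_invol e).symm
      · intro he
        apply h₁
        rw [← g.dinv_invol e, he, g.dinv_invol]
  · rintro ⟨P, ⟨d, d', hd, hd'⟩, hP⟩ h
    have key : ∀ e, g.ReachAvoiding x d e → P (g.vert e) := by
      intro e hr
      induction hr with
      | refl => exact hd
      | tail _ hs ih =>
        rcases hs with hs | ⟨rfl, h₁, h₂⟩
        · rwa [← hs]
        · exact (hP _ h₁ h₂).1 ih
    exact hd' (key d' (h d d'))

/-- In a connected graph, every cut separating two darts is crossed by an edge. -/
lemma Connected.cut_trivial {g : CubicGraph n} (hg : g.Connected) {P : Fin (2 * n) → Prop}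
    (hP : ∀ d, P (g.vert d) ↔ P (g.vert (g.dinv d))) {d d' : Fin (6 * n)}
    (hd : P (g.vert d)) : P (g.vert d') := by
  have hr := hg d d'
  unfold Reach at hr
  induction hr with
  | refl => exact hd
  | tail _ hs ih =>
    rcases hs with hs | rfl
    · rwa [← hs]
    · exact (hP _).1 ih

/-- If the edge of `x` is the unique bridge of a connected graph, then exchanging a dart at one
of its endpoints with a dart at the other produces a bridgeless graph. -/
lemma swapDarts_bridgeless {g : CubicGraph n} (hg : g.Connected) {x q r : Fin (6 * n)}
    (hx : g.IsBridge x) (huniq : ∀ y, g.IsBridge y → y = x ∨ y = g.dinv x)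
    (hq : g.vert q = g.vert x) (hqx : q ≠ x)
    (hr : g.vert r = g.vert (g.dinv x)) (hrx : r ≠ g.dinv x) :
    (g.swapDarts q r).Bridgeless := by
  obtain ⟨P, ⟨d₀, d₁, hd₀, hd₁⟩, hP⟩ := (g.isBridge_iff_exists_cut x).1 hx
  have hPx : ¬ (P (g.vert x) ↔ P (g.vert (g.dinv x))) := by
    intro h
    refine hd₁ (hg.cut_trivial (fun d => ?_) hd₀)
    by_cases h₁ : d = x
    · rwa [h₁]
    by_cases h₂ : d = g.dinv x
    · rw [h₂, g.dinv_invol]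
      exact h.symm
    exact hP d h₁ h₂
  intro y hy
  obtain ⟨Q, ⟨e₀, e₁, he₀, he₁⟩, hQ⟩ := ((g.swapDarts q r).isBridge_iff_exists_cut y).1 hy
  change Q (g.vert (Equiv.swap q r e₀)) at he₀
  change ¬ Q (g.vert (Equiv.swap q r e₁)) at he₁
  change ∀ d, d ≠ y → d ≠ g.dinv y →
    (Q (g.vert (Equiv.swap q r d)) ↔ Q (g.vert (Equiv.swap q r (g.dinv d)))) at hQ
  have hqx' : q ≠ g.dinv x := by
    rintro rfl
    exact hPx (by rw [hq])
  have hrx' : r ≠ x := by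
    rintro rfl
    exact hPx (by rw [← hr])
  have hsx : Equiv.swap q r x = x := Equiv.swap_apply_of_ne_of_ne hqx.symm hrx'.symm
  have hsx' : Equiv.swap q r (g.dinv x) = g.dinv x :=
    Equiv.swap_apply_of_ne_of_ne hqx'.symm hrx.symm
  by_cases huv : Q (g.vert x) ↔ Q (g.vert (g.dinv x))
  · have hs : ∀ d, Q (g.vert (Equiv.swap q r d)) ↔ Q (g.vert d) := by
      intro d
      by_cases h₁ : d = q
      · rw [h₁, Equiv.swap_apply_left, hr, hq]
        exact huv.symm
      by_cases h₂ : d = r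
      · rw [h₂, Equiv.swap_apply_right, hr, hq]
        exact huv
      rw [Equiv.swap_apply_of_ne_of_ne h₁ h₂]
    simp only [hs] at hQ he₀ he₁
    have hyx := huniq y ((g.isBridge_iff_exists_cut y).2 ⟨Q, ⟨e₀, e₁, he₀, he₁⟩, hQ⟩)
    refine he₁ (hg.cut_trivial (fun d => ?_) he₀)
    by_cases h₁ : d = x
    · rwa [h₁]
    by_cases h₂ : d = g.dinv x
    · rw [h₂, g.dinv_invol]
      exact huv.symm
    rcases hyx with rfl | rfl
    · exact hQ d h₁ h₂
    · exact hQ d h₂ (by rwa [g.dinv_invol])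
  · have hcross : ∀ d, d ≠ x → d ≠ g.dinv x →
        (Q (g.vert (Equiv.swap q r d)) ↔ Q (g.vert (Equiv.swap q r (g.dinv d)))) := by
      have hyx : x = y ∨ x = g.dinv y := by
        by_contra! h
        have := hQ x h.1 h.2
        rw [hsx, hsx'] at this
        exact huv this
      rcases hyx with rfl | rfl
      · exact hQ
      · intro d h₁ h₂
        exact hQ d (by rwa [g.dinv_invol] at h₂) h₁
    have hqq : g.dinv q ≠ q := g.dinv_ne q
    have hPq := hP q hqx hqx'
    rw [hq] at hPq
    have hqr : g.dinv q ≠ r := by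
      intro h
      rw [h, hr] at hPq
      exact hPx hPq
    have hQq : Q (g.vert (g.dinv x)) ↔ Q (g.vert (g.dinv q)) := by
      have := hcross q hqx hqx'
      rwa [Equiv.swap_apply_left, Equiv.swap_apply_of_ne_of_ne hqq hqr, hr] at this
    -- The cut that agrees with `Q` on the side of `x` and is constant on the other side.
    obtain ⟨R, hRin, hRout⟩ : ∃ R : Fin (2 * n) → Prop,
        (∀ w, (P w ↔ P (g.vert x)) → (R w ↔ Q w)) ∧
        ∀ w, ¬ (P w ↔ P (g.vert x)) → (R w ↔ Q (g.vert x)) := by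
      refine ⟨fun w => ((P w ↔ P (g.vert x)) → Q w) ∧
        (¬ (P w ↔ P (g.vert x)) → Q (g.vert x)), fun w h => ?_, fun w h => ?_⟩ <;> simp [h]
    have hRx : R (g.vert x) ↔ Q (g.vert x) := hRin _ Iff.rfl
    have hRx' : R (g.vert (g.dinv x)) ↔ Q (g.vert x) := hRout _ fun h => hPx h.symm
    have hRq : ¬ (R (g.vert q) ↔ R (g.vert (g.dinv q))) := by
      rw [hq, hRx, hRin _ hPq.symm, ← hQq]
      exact huv
    have hbridge : g.IsBridge q := by
      refine (g.isBridge_iff_exists_cut q).2 ⟨R, ?_, fun d h₁ h₂ => ?_⟩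
      · by_cases h : R (g.vert q)
        · exact ⟨q, g.dinv q, h, fun h' => hRq ⟨fun _ => h', fun _ => h⟩⟩
        · exact ⟨g.dinv q, q, by_contra fun h' => hRq (iff_of_false h h'), h⟩
      · by_cases hd : d = x
        · subst hd
          exact hRx.trans hRx'.symm
        by_cases hd' : d = g.dinv x
        · subst hd'
          rw [g.dinv_invol]
          exact hRx'.trans hRx.symm
        have hPd := hP d hd hd'
        by_cases hside : P (g.vert d) ↔ P (g.vert x)
        · have hdr : d ≠ r := by
            rintro rfl
            rw [hr] at hside
            exact hPx hside.symm
          have hdr' : g.dinv d ≠ r := by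
            intro h
            rw [h, hr] at hPd
            exact hPx (hside.symm.trans hPd)
          have hdq' : g.dinv d ≠ q := by
            intro h
            exact h₂ (by rw [← h, g.dinv_invol])
          have := hcross d hd hd'
          rw [Equiv.swap_apply_of_ne_of_ne h₁ hdr,
            Equiv.swap_apply_of_ne_of_ne hdq' hdr'] at this
          exact (hRin _ hside).trans (this.trans (hRin _ (hPd.symm.trans hside)).symm)
        · exact (hRout _ hside).trans (hRout _ fun h => hside (hPd.trans h)).symm
    rcases huniq q hbridge with h | h
    · exact hqx h
    · exact hqx' h

lemma mem_othersAt {g : CubicGraph n} {x d : Fin (6 * n)} :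
    d ∈ g.othersAt x ↔ d ≠ x ∧ g.vert d = g.vert x := by
  simp [othersAt]

lemma IsBridge.not_isLoop {g : CubicGraph n} (hg : g.Connected) {x : Fin (6 * n)}
    (hx : g.IsBridge x) : ¬ g.IsLoop x := by
  intro hl
  obtain ⟨P, ⟨d₀, d₁, hd₀, hd₁⟩, hP⟩ := (g.isBridge_iff_exists_cut x).1 hx
  refine hd₁ (hg.cut_trivial (fun d => ?_) hd₀)
  by_cases h₁ : d = x
  · rw [h₁, show g.vert (g.dinv x) = g.vert x from hl]
  by_cases h₂ : d = g.dinv x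
  · rw [h₂, g.dinv_invol, show g.vert (g.dinv x) = g.vert x from hl]
  exact hP d h₁ h₂

end CubicGraph

/-- If the edge of the dart `x` is the unique bridge of the connected cubic
graph `g`, then both Whitehead moves on it produce a bridgeless graph. -/
theorem unique_bridge_moves_bridgeless (n : ℕ) (g : CubicGraph n) (hg : g.Connected)
    (x : Fin (6 * n)) (hx : g.IsBridge x)
    (huniq : ∀ y, g.IsBridge y → y = x ∨ y = g.dinv x) :
    ∀ i : Fin 2, (g.wh i x).Bridgeless := by
  intro i
  obtain ⟨hqx, hq⟩ := CubicGraph.mem_othersAt.1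
    (Finset.max'_mem _ (g.othersAt_nonempty x))
  rw [CubicGraph.wh, if_neg (hx.not_isLoop hg)]
  split_ifs
  · obtain ⟨hrx, hr⟩ := CubicGraph.mem_othersAt.1
      (Finset.min'_mem _ (g.othersAt_nonempty (g.dinv x)))
    exact CubicGraph.swapDarts_bridgeless hg hx huniq hq hqx hr hrx
  · obtain ⟨hrx, hr⟩ := CubicGraph.mem_othersAt.1
      (Finset.max'_mem _ (g.othersAt_nonempty (g.dinv x)))
    exact CubicGraph.swapDarts_bridgeless hg hx huniq hq hqx hr hrx
end

section
/- Let g be a cubic (trivalent) graph, let e, f ∈ E(g), fix k ∈ {1,2}, and suppose there is a graph isomorphism ψ : w_e^{(k)}(g) → w_f^{(k)}(g) such that ψ maps the transformed edge e* to the transformed edge f*, maps the endpoints e₁*, e₂* of e* to the endpoints f₁*, f₂* of f*, and maps the four neighbouring vertices v₁*, v₂*, v₃*, v₄* of e* to the corresponding neighbouring vertices w₁*, w₂*, w₃*, w₄* of f*. Then there exists an automorphism ψ̄ of g with ψ̄(e) = f. -/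
namespace CubicGraph

variable {n : ℕ}

/-- Three distinct darts at a common vertex are all the darts there. -/
lemma eq_of_vert_eq (g : CubicGraph n) {v : Fin (2 * n)} {a b c d : Fin (6 * n)}
    (ha : g.vert a = v) (hb : g.vert b = v) (hc : g.vert c = v)
    (hab : a ≠ b) (hac : a ≠ c) (hbc : b ≠ c) (hd : g.vert d = v) :
    d = a ∨ d = b ∨ d = c := by
  have hsub : ({a, b, c} : Finset (Fin (6 * n))) ⊆ Finset.univ.filter fun d => g.vert d = v := by
    intro y hy
    simp only [Finset.mem_insert, Finset.mem_singleton] at hy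
    rcases hy with rfl | rfl | rfl <;> simpa
  have hcard : ({a, b, c} : Finset (Fin (6 * n))).card = 3 :=
    Finset.card_eq_three.2 ⟨a, b, c, hab, hac, hbc, rfl⟩
  have heq := Finset.eq_of_subset_of_card_le hsub (by rw [g.regular, hcard])
  have hmem : d ∈ Finset.univ.filter fun d => g.vert d = v := by simpa
  rw [← heq] at hmem
  simpa using hmem

/-- The darts around the non-loop edge of `x`: `p₁`, `p₂` are the other darts at the base of
`x`, and `r`, `s` are the other darts at the base of `g.dinv x`. -/
structure IsFrame (g : CubicGraph n) (x p₁ p₂ r s : Fin (6 * n)) : Prop where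
  not_loop : g.vert (g.dinv x) ≠ g.vert x
  vert_p₁ : g.vert p₁ = g.vert x
  vert_p₂ : g.vert p₂ = g.vert x
  vert_r : g.vert r = g.vert (g.dinv x)
  vert_s : g.vert s = g.vert (g.dinv x)
  p₁_ne : p₁ ≠ x
  p₂_ne : p₂ ≠ x
  r_ne : r ≠ g.dinv x
  s_ne : s ≠ g.dinv x
  p₁_ne_p₂ : p₁ ≠ p₂
  r_ne_s : r ≠ s

namespace IsFrame

variable {g : CubicGraph n} {x p₁ p₂ r s : Fin (6 * n)}

lemma symm (h : g.IsFrame x p₁ p₂ r s) : g.IsFrame (g.dinv x) s r p₂ p₁ where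
  not_loop := by rw [g.dinv_invol]; exact h.not_loop.symm
  vert_p₁ := h.vert_s
  vert_p₂ := h.vert_r
  vert_r := by rw [g.dinv_invol]; exact h.vert_p₂
  vert_s := by rw [g.dinv_invol]; exact h.vert_p₁
  p₁_ne := h.s_ne
  p₂_ne := h.r_ne
  r_ne := by rw [g.dinv_invol]; exact h.p₂_ne
  s_ne := by rw [g.dinv_invol]; exact h.p₁_ne
  p₁_ne_p₂ := h.r_ne_s.symm
  r_ne_s := h.p₁_ne_p₂.symm

lemma eq_of_vert (h : g.IsFrame x p₁ p₂ r s) {d : Fin (6 * n)} (hd : g.vert d = g.vert x) :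
    d = x ∨ d = p₁ ∨ d = p₂ :=
  g.eq_of_vert_eq rfl h.vert_p₁ h.vert_p₂ h.p₁_ne.symm h.p₂_ne.symm h.p₁_ne_p₂ hd

lemma eq_of_vert_dinv (h : g.IsFrame x p₁ p₂ r s) {d : Fin (6 * n)}
    (hd : g.vert d = g.vert (g.dinv x)) : d = g.dinv x ∨ d = r ∨ d = s :=
  g.eq_of_vert_eq rfl h.vert_r h.vert_s h.r_ne.symm h.s_ne.symm h.r_ne_s hd

lemma ne_of_vert (h : g.IsFrame x p₁ p₂ r s) {a b : Fin (6 * n)}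
    (ha : g.vert a = g.vert x) (hb : g.vert b = g.vert (g.dinv x)) : a ≠ b := by
  rintro rfl
  exact h.not_loop (hb.symm.trans ha)

/-- The vertices of the darts of a frame after the move. -/
lemma swapDarts_vert (h : g.IsFrame x p₁ p₂ r s) :
    (g.swapDarts p₂ r).vert x = g.vert x ∧
    (g.swapDarts p₂ r).vert (g.dinv x) = g.vert (g.dinv x) ∧
    (g.swapDarts p₂ r).vert p₁ = g.vert x ∧
    (g.swapDarts p₂ r).vert r = g.vert x ∧
    (g.swapDarts p₂ r).vert p₂ = g.vert (g.dinv x) ∧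
    (g.swapDarts p₂ r).vert s = g.vert (g.dinv x) := by
  refine ⟨?_, ?_, ?_, ?_, ?_, ?_⟩
  · simp only [swapDarts]
    rw [Equiv.swap_apply_of_ne_of_ne h.p₂_ne.symm (h.ne_of_vert rfl h.vert_r)]
  · simp only [swapDarts]
    rw [Equiv.swap_apply_of_ne_of_ne (h.ne_of_vert h.vert_p₂ rfl).symm h.r_ne.symm]
  · simp only [swapDarts]
    rw [Equiv.swap_apply_of_ne_of_ne h.p₁_ne_p₂ (h.ne_of_vert h.vert_p₁ h.vert_r), h.vert_p₁]
  · simp only [swapDarts]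
    rw [Equiv.swap_apply_right, h.vert_p₂]
  · simp only [swapDarts]
    rw [Equiv.swap_apply_left, h.vert_r]
  · simp only [swapDarts]
    rw [Equiv.swap_apply_of_ne_of_ne (h.ne_of_vert h.vert_p₂ h.vert_s).symm h.r_ne_s.symm,
      h.vert_s]

lemma eq_of_swapDarts_vert (h : g.IsFrame x p₁ p₂ r s) {d : Fin (6 * n)}
    (hd : (g.swapDarts p₂ r).vert d = g.vert x) : d = x ∨ d = p₁ ∨ d = r := by
  obtain ⟨h1, -, h3, h4, -, -⟩ := h.swapDarts_vert
  exact (g.swapDarts p₂ r).eq_of_vert_eq h1 h3 h4 h.p₁_ne.symm (h.ne_of_vert rfl h.vert_r)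
    (h.ne_of_vert h.vert_p₁ h.vert_r) hd

lemma eq_of_swapDarts_vert_dinv (h : g.IsFrame x p₁ p₂ r s) {d : Fin (6 * n)}
    (hd : (g.swapDarts p₂ r).vert d = g.vert (g.dinv x)) : d = g.dinv x ∨ d = p₂ ∨ d = s := by
  obtain ⟨-, h2, -, -, h5, h6⟩ := h.swapDarts_vert
  exact (g.swapDarts p₂ r).eq_of_vert_eq h2 h5 h6 (h.ne_of_vert h.vert_p₂ rfl).symm
    h.s_ne.symm (h.ne_of_vert h.vert_p₂ h.vert_s) hd

/-- A connected cubic graph containing a triple edge has no loops. -/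
lemma not_isLoop_of_triple (h : g.IsFrame x p₁ p₂ r s) (hg : g.Connected)
    (h₁ : g.vert (g.dinv p₁) = g.vert (g.dinv x))
    (h₂ : g.vert (g.dinv p₂) = g.vert (g.dinv x)) (d : Fin (6 * n)) :
    g.vert (g.dinv d) ≠ g.vert d := by
  have key : ∀ d, (g.vert d = g.vert x ∧ g.vert (g.dinv d) = g.vert (g.dinv x)) ∨
      (g.vert d = g.vert (g.dinv x) ∧ g.vert (g.dinv d) = g.vert x) := by
    intro d
    induction hg x d with
    | refl => exact Or.inl ⟨rfl, rfl⟩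
    | @tail b c _ hbc ih =>
      rcases hbc with hbc | rfl
      · rcases ih with ⟨ih, -⟩ | ⟨ih, -⟩
        · left
          rw [hbc] at ih
          refine ⟨ih, ?_⟩
          rcases h.eq_of_vert ih with rfl | rfl | rfl <;> first | rfl | assumption
        · right
          rw [hbc] at ih
          refine ⟨ih, ?_⟩
          have inj := Function.Involutive.injective g.dinv_invol
          rcases g.eq_of_vert_eq rfl h₁ h₂ (fun e => h.p₁_ne (inj e).symm)
            (fun e => h.p₂_ne (inj e).symm) (fun e => h.p₁_ne_p₂ (inj e)) ih with
            rfl | rfl | rfl <;> rw [g.dinv_invol]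
          · exact h.vert_p₁
          · exact h.vert_p₂
      · rw [g.dinv_invol]
        tauto
  have := h.not_loop
  rcases key d with ⟨ha, hb⟩ | ⟨ha, hb⟩ <;> rw [ha, hb]
  · exact this
  · exact this.symm

end IsFrame

/-- Composition of isomorphisms. -/
def Iso.trans {g₁ g₂ g₃ : CubicGraph n} (φ : Iso g₁ g₂) (ψ : Iso g₂ g₃) : Iso g₁ g₃ where
  dartEquiv := φ.dartEquiv.trans ψ.dartEquiv
  vertEquiv := φ.vertEquiv.trans ψ.vertEquiv
  map_dinv d := by simp [ψ.map_dinv, φ.map_dinv]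
  map_vert d := by simp [ψ.map_vert, φ.map_vert]

lemma swap_dinv_comm (g : CubicGraph n) (a d : Fin (6 * n)) :
    g.dinv (Equiv.swap a (g.dinv a) d) = Equiv.swap a (g.dinv a) (g.dinv d) := by
  have hinv := g.dinv_invol
  simp only [Equiv.swap_apply_def]
  grind

/-- Two parallel edges, or the two darts of a loop, can be exchanged by an automorphism. -/
lemma exists_iso_swap (g : CubicGraph n) {a b : Fin (6 * n)} (hab : g.vert a = g.vert b)
    (hab' : g.vert (g.dinv a) = g.vert (g.dinv b)) :
    ∃ τ : Iso g g, τ.vertEquiv = Equiv.refl _ ∧ τ.dartEquiv a = b ∧ τ.dartEquiv b = a ∧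
      ∀ d, d ≠ a → d ≠ b → d ≠ g.dinv a → d ≠ g.dinv b → τ.dartEquiv d = d := by
  have hinv := g.dinv_invol
  have hne := g.dinv_ne
  by_cases h : g.dinv a = b
  · subst h
    refine ⟨⟨Equiv.swap a (g.dinv a), Equiv.refl _, g.swap_dinv_comm a, ?_⟩, rfl, ?_, ?_, ?_⟩
    · intro d
      simp only [Equiv.swap_apply_def, Equiv.refl_apply]
      grind
    · simp
    · simp
    · intro d h1 h2 _ _
      exact Equiv.swap_apply_of_ne_of_ne h1 h2
  · refine ⟨⟨(Equiv.swap a b).trans (Equiv.swap (g.dinv a) (g.dinv b)), Equiv.refl _, ?_, ?_⟩,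
      rfl, ?_, ?_, ?_⟩
    · intro d
      simp only [Equiv.swap_apply_def, Equiv.trans_apply]
      grind
    · intro d
      simp only [Equiv.swap_apply_def, Equiv.trans_apply, Equiv.refl_apply]
      grind
    · simp only [Equiv.swap_apply_def, Equiv.trans_apply]
      grind
    · simp only [Equiv.swap_apply_def, Equiv.trans_apply]
      grind
    · intro d h1 h2 h3 h4
      simp [Equiv.swap_apply_of_ne_of_ne, h1, h2, h3, h4]

section Descent

variable {g : CubicGraph n} {x p₁ p₂ r s x' p₁' p₂' r' s' : Fin (6 * n)}

lemma Iso.apply_swapDarts_vert {a b a' b' : Fin (6 * n)}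
    (ψ : Iso (g.swapDarts a b) (g.swapDarts a' b')) (d : Fin (6 * n)) :
    ψ.vertEquiv (g.vert d) =
      g.vert (Equiv.swap a' b' (Equiv.swap (ψ.dartEquiv a) (ψ.dartEquiv b) (ψ.dartEquiv d))) := by
  have h := ψ.map_vert (Equiv.swap a b d)
  simp only [swapDarts, Equiv.swap_apply_self] at h
  rw [← h, ψ.dartEquiv.injective.map_swap]

/-- An isomorphism of moved graphs matching the exchanged darts is an automorphism of `g`. -/
lemma exists_iso_of_straight (ψ : Iso (g.swapDarts p₂ r) (g.swapDarts p₂' r'))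
    (hp : ψ.dartEquiv p₂ = p₂') (hr : ψ.dartEquiv r = r') :
    ∃ φ : Iso g g, φ.dartEquiv = ψ.dartEquiv := by
  refine ⟨⟨ψ.dartEquiv, ψ.vertEquiv, ψ.map_dinv, fun d => ?_⟩, rfl⟩
  rw [ψ.apply_swapDarts_vert, hp, hr, Equiv.swap_apply_self]

/-- An isomorphism of moved graphs exchanging the roles of the two ends of the edge becomes an
automorphism of `g` after reversing the edge. -/
lemma exists_iso_of_crossed (h' : g.IsFrame x' p₁' p₂' r' s')
    (ψ : Iso (g.swapDarts p₂ r) (g.swapDarts p₂' r')) (hx : ψ.dartEquiv x = x')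
    (hp : ψ.dartEquiv p₂ = s') (hr : ψ.dartEquiv r = p₁') :
    ∃ φ : Iso g g, φ.dartEquiv x = g.dinv x' := by
  refine ⟨⟨ψ.dartEquiv.trans (Equiv.swap x' (g.dinv x')),
    ψ.vertEquiv.trans (Equiv.swap (g.vert x') (g.vert (g.dinv x'))), fun d => ?_, fun d => ?_⟩, ?_⟩
  · simp only [Equiv.trans_apply]
    rw [g.swap_dinv_comm]
    exact congrArg _ (ψ.map_dinv d)
  · simp only [Equiv.trans_apply]
    rw [ψ.apply_swapDarts_vert, hp, hr]
    generalize ψ.dartEquiv d = e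
    have hu := h'.eq_of_vert (d := e)
    have hv := h'.eq_of_vert_dinv (d := e)
    obtain ⟨h1, h2, h3, h4, h5, h6, h7, h8, h9, h10, h11⟩ := h'
    simp only [Equiv.swap_apply_def]
    grind
  · simp [hx]

/-- The case where the darts based at the far end of the edge are exchanged. -/
lemma exists_iso_of_mixed (hg : g.Connected) (h : g.IsFrame x p₁ p₂ r s)
    (h' : g.IsFrame x' p₁' p₂' r' s') (ψ : Iso (g.swapDarts p₂ r) (g.swapDarts p₂' r'))
    (hx : ψ.dartEquiv x = x') (hp₁ : ψ.dartEquiv p₁ = p₁') (hr : ψ.dartEquiv r = r')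
    (hp₂ : ψ.dartEquiv p₂ = s') (hs : ψ.dartEquiv s = p₂')
    (hfar : ψ.vertEquiv ((g.swapDarts p₂ r).vert (g.dinv p₂)) =
      (g.swapDarts p₂' r').vert (g.dinv p₂')) :
    ∃ φ : Iso g g, φ.dartEquiv x = x' := by
  have hinv := g.dinv_invol
  have hψ : ∀ d, g.dinv (ψ.dartEquiv d) = ψ.dartEquiv (g.dinv d) := ψ.map_dinv
  have hpar : (g.swapDarts p₂' r').vert (g.dinv p₂') = (g.swapDarts p₂' r').vert (g.dinv s') := by
    rw [← hfar, ← ψ.map_vert, ← hψ, hp₂]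
  obtain ⟨v1, v2, v3, v4, v5, v6⟩ := h'.swapDarts_vert
  obtain ⟨τ, -, -, hτs, hτ⟩ := (g.swapDarts p₂' r').exists_iso_swap (v5.trans v6.symm) hpar
  have hdx : g.dinv p₂' ≠ x' := fun e => h'.ne_of_vert h'.vert_p₂ rfl (by rw [← e, hinv])
  have hdx' : g.dinv s' ≠ x' := fun e => h'.s_ne (by rw [← e, hinv])
  have hinj := ψ.dartEquiv.injective
  have hinvj : Function.Injective g.dinv := Function.Involutive.injective hinv
  have hsp : s' ≠ p₂' := (h'.ne_of_vert h'.vert_p₂ h'.vert_s).symm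
  have hrfix : r' ≠ g.dinv p₂' ∧ r' ≠ g.dinv s' := by
    refine ⟨fun e => ?_, fun e => ?_⟩
    · have e' : g.dinv s' = p₁' := by
        have : (g.swapDarts p₂' r').vert (g.dinv s') = g.vert x' := by rw [← hpar, ← e, v4]
        rcases h'.eq_of_swapDarts_vert this with e' | e' | e'
        · exact absurd e' hdx'
        · exact e'
        · exact absurd (hinvj (e'.trans e)) hsp
      have hloop : g.dinv p₂ = p₁ := hinj (by rw [← hψ, hp₂, hp₁, e'])
      refine h'.not_isLoop_of_triple hg ?_ ?_ p₂ ?_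
      · rw [← e', hinv, h'.vert_s]
      · rw [← e, h'.vert_r]
      · rw [hloop, h.vert_p₁, h.vert_p₂]
    · have e' : g.dinv p₂' = p₁' := by
        have : (g.swapDarts p₂' r').vert (g.dinv p₂') = g.vert x' := by rw [hpar, ← e, v4]
        rcases h'.eq_of_swapDarts_vert this with e' | e' | e'
        · exact absurd e' hdx
        · exact e'
        · exact absurd (hinvj (e'.trans e)).symm hsp
      have h₂ : g.dinv p₂ = r := hinj (by rw [← hψ, hp₂, hr, e])
      have h₁ : g.dinv s = p₁ := hinj (by rw [← hψ, hs, hp₁, e'])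
      refine h.not_isLoop_of_triple hg ?_ ?_ p₂' ?_
      · rw [← h₁, hinv, h.vert_s]
      · rw [h₂, h.vert_r]
      · rw [e', h'.vert_p₁, h'.vert_p₂]
  have hrr : τ.dartEquiv r' = r' :=
    hτ r' (h'.ne_of_vert h'.vert_p₂ h'.vert_r).symm h'.r_ne_s hrfix.1 hrfix.2
  have hxx : τ.dartEquiv x' = x' :=
    hτ x' h'.p₂_ne.symm (h'.ne_of_vert rfl h'.vert_s) hdx.symm hdx'.symm
  obtain ⟨φ, hφ⟩ := exists_iso_of_straight (ψ.trans τ) (by simp [Iso.trans, hp₂, hτs])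
    (by simp [Iso.trans, hr, hrr])
  exact ⟨φ, by rw [hφ]; simp [Iso.trans, hx, hxx]⟩

lemma exists_iso_of_moved (hg : g.Connected) (h : g.IsFrame x p₁ p₂ r s)
    (h' : g.IsFrame x' p₁' p₂' r' s') (ψ : Iso (g.swapDarts p₂ r) (g.swapDarts p₂' r'))
    (hx : ψ.dartEquiv x = x')
    (hfar₂ : ψ.vertEquiv ((g.swapDarts p₂ r).vert (g.dinv p₂)) =
      (g.swapDarts p₂' r').vert (g.dinv p₂'))
    (hfar_r : ψ.vertEquiv ((g.swapDarts p₂ r).vert (g.dinv r)) =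
      (g.swapDarts p₂' r').vert (g.dinv r')) :
    ∃ φ : Iso g g, φ.dartEquiv x = x' ∨ φ.dartEquiv x = g.dinv x' := by
  have hψ : ∀ d, g.dinv (ψ.dartEquiv d) = ψ.dartEquiv (g.dinv d) := ψ.map_dinv
  have hdx : ψ.dartEquiv (g.dinv x) = g.dinv x' := by rw [← hψ, hx]
  have hinj := ψ.dartEquiv.injective
  obtain ⟨v1, v2, v3, v4, v5, v6⟩ := h.swapDarts_vert
  obtain ⟨v1', v2', v3', v4', v5', v6'⟩ := h'.swapDarts_vert
  have hu : ψ.vertEquiv (g.vert x) = g.vert x' := by rw [← v1, ← ψ.map_vert, hx, v1']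
  have hv : ψ.vertEquiv (g.vert (g.dinv x)) = g.vert (g.dinv x') := by
    rw [← v2, ← ψ.map_vert, hdx, v2']
  have cu : ∀ d, (g.swapDarts p₂ r).vert d = g.vert x → d ≠ x →
      ψ.dartEquiv d = p₁' ∨ ψ.dartEquiv d = r' := by
    intro d hd hne
    rcases h'.eq_of_swapDarts_vert (by rw [ψ.map_vert, hd, hu]) with e | e
    · exact absurd (hinj (e.trans hx.symm)) hne
    · exact e
  have cv : ∀ d, (g.swapDarts p₂ r).vert d = g.vert (g.dinv x) → d ≠ g.dinv x →
      ψ.dartEquiv d = p₂' ∨ ψ.dartEquiv d = s' := by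
    intro d hd hne
    rcases h'.eq_of_swapDarts_vert_dinv (by rw [ψ.map_vert, hd, hv]) with e | e
    · exact absurd (hinj (e.trans hdx.symm)) hne
    · exact e
  have dp : ψ.dartEquiv p₁ ≠ ψ.dartEquiv r := hinj.ne (h.ne_of_vert h.vert_p₁ h.vert_r)
  have dr : ψ.dartEquiv p₂ ≠ ψ.dartEquiv s := hinj.ne (h.ne_of_vert h.vert_p₂ h.vert_s)
  have cp₁ := cu p₁ v3 h.p₁_ne
  have cp₂ := cv p₂ v5 (h.ne_of_vert h.vert_p₂ rfl)
  have cs := cv s v6 h.s_ne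
  rcases cu r v4 (h.ne_of_vert rfl h.vert_r).symm with hr | hr
  · rcases cp₂ with hp₂ | hp₂
    · have hs : ψ.dartEquiv s = s' := cs.resolve_left fun e => dr (hp₂.trans e.symm)
      have hp₁ : ψ.dartEquiv p₁ = r' := cp₁.resolve_left fun e => dp (e.trans hr.symm)
      have mixed : ∀ m m' : CubicGraph n, m = g.swapDarts r p₂ → m' = g.swapDarts r' p₂' →
          ∀ ψ : Iso m m', ψ.dartEquiv (g.dinv x) = g.dinv x' → ψ.dartEquiv s = s' →
          ψ.dartEquiv p₂ = p₂' → ψ.dartEquiv r = p₁' → ψ.dartEquiv p₁ = r' →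
          ψ.vertEquiv (m.vert (g.dinv r)) = m'.vert (g.dinv r') →
          ∃ φ : Iso g g, φ.dartEquiv (g.dinv x) = g.dinv x' := by
        rintro _ _ rfl rfl ψ a1 a2 a3 a4 a5 a6
        exact exists_iso_of_mixed hg h.symm h'.symm ψ a1 a2 a3 a4 a5 a6
      obtain ⟨φ, hφ⟩ := mixed _ _ (by simp only [swapDarts, Equiv.swap_comm])
        (by simp only [swapDarts, Equiv.swap_comm]) ψ hdx hs hp₂ hr hp₁ hfar_r
      refine ⟨φ, Or.inl ?_⟩
      rw [← φ.map_dinv] at hφ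
      exact Function.Involutive.injective g.dinv_invol hφ
    · obtain ⟨φ, hφ⟩ := exists_iso_of_crossed h' ψ hx hp₂ hr
      exact ⟨φ, Or.inr hφ⟩
  · rcases cp₂ with hp₂ | hp₂
    · obtain ⟨φ, hφ⟩ := exists_iso_of_straight ψ hp₂ hr
      exact ⟨φ, Or.inl (by rw [hφ, hx])⟩
    · have hs : ψ.dartEquiv s = p₂' := cs.resolve_right fun e => dr (hp₂.trans e.symm)
      have hp₁ : ψ.dartEquiv p₁ = p₁' := cp₁.resolve_right fun e => dp (e.trans hr.symm)
      obtain ⟨φ, hφ⟩ := exists_iso_of_mixed hg h h' ψ hx hp₁ hr hp₂ hs hfar₂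
      exact ⟨φ, Or.inl hφ⟩

end Descent

end CubicGraph

/-- Conversely, if for a fixed type `k` of Whitehead move there is an
isomorphism `ψ : w_e^{(k)}(g) ≅ w_f^{(k)}(g)` carrying the transformed edge `e*` to `f*`,
matching endpoints and the four neighbouring vertices correspondingly, then `g` has an
automorphism carrying the edge `e` to the edge `f`. -/
theorem iso_of_moved_gives_automorphism (n : ℕ) (g : CubicGraph n) (hg : g.Connected)
    (k : Fin 2) (x p₁ p₂ r₁ r₂ x' p₁' p₂' r₁' r₂' : Fin (6 * n))
    (hx : ¬ g.IsLoop x) (hx' : ¬ g.IsLoop x')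
    (hp₁ : g.vert p₁ = g.vert x) (hp₂ : g.vert p₂ = g.vert x)
    (hp₁x : p₁ ≠ x) (hp₂x : p₂ ≠ x) (hp₁₂ : p₁ ≠ p₂)
    (hr₁ : g.vert r₁ = g.vert (g.dinv x)) (hr₂ : g.vert r₂ = g.vert (g.dinv x))
    (hr₁x : r₁ ≠ g.dinv x) (hr₂x : r₂ ≠ g.dinv x) (hr₁₂ : r₁ ≠ r₂)
    (hp₁' : g.vert p₁' = g.vert x') (hp₂' : g.vert p₂' = g.vert x')
    (hp₁x' : p₁' ≠ x') (hp₂x' : p₂' ≠ x') (hp₁₂' : p₁' ≠ p₂')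
    (hr₁' : g.vert r₁' = g.vert (g.dinv x')) (hr₂' : g.vert r₂' = g.vert (g.dinv x'))
    (hr₁x' : r₁' ≠ g.dinv x') (hr₂x' : r₂' ≠ g.dinv x') (hr₁₂' : r₁' ≠ r₂')
    (m m' : CubicGraph n)
    (hm : m = g.swapDarts p₂ (if k = 0 then r₁ else r₂))
    (hm' : m' = g.swapDarts p₂' (if k = 0 then r₁' else r₂'))
    (ψ : CubicGraph.Iso m m')
    (hψx : ψ.dartEquiv x = x')
    (hE₁ : ψ.vertEquiv (m.vert x) = m'.vert x')
    (hE₂ : ψ.vertEquiv (m.vert (m.dinv x)) = m'.vert (m'.dinv x'))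
    (hv₁ : ψ.vertEquiv (m.vert (m.dinv p₁)) = m'.vert (m'.dinv p₁'))
    (hv₂ : ψ.vertEquiv (m.vert (m.dinv p₂)) = m'.vert (m'.dinv p₂'))
    (hv₃ : ψ.vertEquiv (m.vert (m.dinv r₁)) = m'.vert (m'.dinv r₁'))
    (hv₄ : ψ.vertEquiv (m.vert (m.dinv r₂)) = m'.vert (m'.dinv r₂')) :
    ∃ φ : CubicGraph.Iso g g, φ.dartEquiv x = x' ∨ φ.dartEquiv x = g.dinv x' := by
  subst hm hm'
  have key : ∀ r s r' s' : Fin (6 * n), g.IsFrame x p₁ p₂ r s → g.IsFrame x' p₁' p₂' r' s' →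
      ∀ m m' : CubicGraph n, m = g.swapDarts p₂ r → m' = g.swapDarts p₂' r' →
      ∀ ψ : CubicGraph.Iso m m', ψ.dartEquiv x = x' →
      ψ.vertEquiv (m.vert (m.dinv p₂)) = m'.vert (m'.dinv p₂') →
      ψ.vertEquiv (m.vert (m.dinv r)) = m'.vert (m'.dinv r') →
      ∃ φ : CubicGraph.Iso g g, φ.dartEquiv x = x' ∨ φ.dartEquiv x = g.dinv x' := by
    rintro r s r' s' h h' _ _ rfl rfl ψ hx h₂ hr
    exact CubicGraph.exists_iso_of_moved hg h h' ψ hx h₂ hr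
  by_cases hk : k = 0
  · exact key r₁ r₂ r₁' r₂'
      ⟨hx, hp₁, hp₂, hr₁, hr₂, hp₁x, hp₂x, hr₁x, hr₂x, hp₁₂, hr₁₂⟩
      ⟨hx', hp₁', hp₂', hr₁', hr₂', hp₁x', hp₂x', hr₁x', hr₂x', hp₁₂', hr₁₂'⟩
      _ _ (by rw [if_pos hk]) (by rw [if_pos hk]) ψ hψx hv₂ hv₃
  · exact key r₂ r₁ r₂' r₁'
      ⟨hx, hp₁, hp₂, hr₂, hr₁, hp₁x, hp₂x, hr₂x, hr₁x, hp₁₂, hr₁₂.symm⟩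
      ⟨hx', hp₁', hp₂', hr₂', hr₁', hp₁x', hp₂x', hr₂x', hr₁x', hp₁₂', hr₁₂'.symm⟩
      _ _ (by rw [if_neg hk]) (by rw [if_neg hk]) ψ hψx hv₂ hv₄
end
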